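/- Let G be the 8 × 8 real symmetric matrix with all diagonal entries equal to 1 and off-diagonal entries (symmetrically extended) G₁₂ = −1, G₁₃ = −3/2, G₂₄ = −3/2, G₃₄ = −1/2, G₃₅ = −1/2, G₄₈ = −1/2, G₅₆ = −√2/2, G₆₇ = −1/2, G₇₈ = −√2/2, and all other off-diagonal entries 0. Then G has exactly 5 positive eigenvalues (with multiplicity), exactly 1 negative eigenvalue, and exactly 2 zero eigenvalues; equivalently G has rank 6 and signature (5,1). -/

import Mathlib

open Real

noncomputable def G10 : Matrix (Fin 8) (Fin 8) ℝ :=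
  !![1, -1, -(3/2), 0, 0, 0, 0, 0;
     -1, 1, 0, -(3/2), 0, 0, 0, 0;
     -(3/2), 0, 1, -(1/2), -(1/2), 0, 0, 0;
     0, -(3/2), -(1/2), 1, 0, 0, 0, -(1/2);
     0, 0, -(1/2), 0, 1, -(Real.sqrt 2 / 2), 0, 0;
     0, 0, 0, 0, -(Real.sqrt 2 / 2), 1, -(1/2), 0;
     0, 0, 0, 0, 0, -(1/2), 1, -(Real.sqrt 2 / 2);
     0, 0, 0, -(1/2), 0, 0, -(Real.sqrt 2 / 2), 1]

namespace Matrix.IsHermitian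

open Matrix

variable {n : Type*} [Fintype n] [DecidableEq n] {A : Matrix n n ℝ}

/-- The quadratic form of a real symmetric matrix is diagonal in an orthonormal eigenbasis. -/
lemma dotProduct_mulVec_eq_sum_eigenvalues (hA : A.IsHermitian) (x : n → ℝ) :
    x ⬝ᵥ A *ᵥ x = ∑ i, hA.eigenvalues i *
      ((hA.eigenvectorUnitary : Matrix n n ℝ)ᵀ *ᵥ x) i ^ 2 := by
  conv_lhs => rw [hA.spectral_theorem, Unitary.conjStarAlgAut_apply]
  rw [star_eq_conjTranspose, conjTranspose_eq_transpose_of_trivial, ← mulVec_mulVec,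
    ← mulVec_mulVec, dotProduct_mulVec, ← mulVec_transpose]
  simp only [dotProduct, mulVec_diagonal, Function.comp_apply, RCLike.ofReal_real_eq_id, id]
  exact Finset.sum_congr rfl fun i _ ↦ by ring

/-- A symmetric matrix that is positive on a `k`-dimensional subspace has at least `k` positive
eigenvalues. -/
lemma card_le_card_pos_eigenvalues (hA : A.IsHermitian) {k : Type*} [Fintype k]
    (B : Matrix n k ℝ) (hB : ∀ c, c ≠ 0 → 0 < (B *ᵥ c) ⬝ᵥ A *ᵥ (B *ᵥ c)) :
    Fintype.card k ≤ (Finset.univ.filter fun j ↦ 0 < hA.eigenvalues j).card := by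
  by_contra! h
  let U : Matrix n n ℝ := hA.eigenvectorUnitary
  let F : (k → ℝ) →ₗ[ℝ] ({j // 0 < hA.eigenvalues j} → ℝ) :=
    LinearMap.funLeft ℝ ℝ Subtype.val ∘ₗ (Uᵀ * B).mulVecLin
  have hF : LinearMap.ker F ≠ ⊥ := F.ker_ne_bot_of_finrank_lt <| by
    simpa [Fintype.card_subtype] using h
  obtain ⟨c, hc, hc0⟩ := Submodule.exists_mem_ne_zero_of_ne_bot hF
  refine (hB c hc0).not_ge ?_
  rw [hA.dotProduct_mulVec_eq_sum_eigenvalues]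
  refine Finset.sum_nonpos fun i _ ↦ ?_
  rcases le_or_gt (hA.eigenvalues i) 0 with hi | hi
  · exact mul_nonpos_of_nonpos_of_nonneg hi (sq_nonneg _)
  · have : (Uᵀ *ᵥ B *ᵥ c) i = 0 := by
      simpa [F, LinearMap.funLeft_apply, ← mulVec_mulVec, mulVec_transpose] using congrFun hc ⟨i, hi⟩
    change _ * (Uᵀ *ᵥ B *ᵥ c) i ^ 2 ≤ 0
    simp [this]

/-- A symmetric matrix that takes a negative value on some vector has a negative eigenvalue. -/
lemma card_neg_eigenvalues_pos (hA : A.IsHermitian) (x : n → ℝ) (hx : x ⬝ᵥ A *ᵥ x < 0) :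
    0 < (Finset.univ.filter fun j ↦ hA.eigenvalues j < 0).card := by
  by_contra! h
  simp only [nonpos_iff_eq_zero, Finset.card_eq_zero, Finset.filter_eq_empty_iff,
    Finset.mem_univ, true_implies, not_lt] at h
  rw [hA.dotProduct_mulVec_eq_sum_eigenvalues] at hx
  exact hx.not_ge (Finset.sum_nonneg fun i _ ↦ mul_nonneg (@h i) (sq_nonneg _))

end Matrix.IsHermitian

open Matrix

lemma G10_pos_on_subspace (c : Fin 5 → ℝ) (hc : c ≠ 0) :
    let B : Matrix (Fin 8) (Fin 5) ℝ :=
      !![0, 0, 0, 0, 0; 0, 0, 0, 0, 0; 1, 0, 0, 0, 0; 0, 1, 0, 0, 0;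
         0, 0, 1, 0, 0; 0, 0, 0, √2 / 2, 0; 0, 0, 0, -(√2 / 2), 0; 0, 0, 0, 0, 1]
    0 < (B *ᵥ c) ⬝ᵥ G10 *ᵥ (B *ᵥ c) := by
  intro B
  have h2 : √2 ^ 2 = (2 : ℝ) := Real.sq_sqrt (by norm_num)
  have key : (B *ᵥ c) ⬝ᵥ G10 *ᵥ (B *ᵥ c) =
      (c 0 + c 1 - (c 2 + c 4)) ^ 2 / 4 + (c 2 + c 4) ^ 2 / 4 +
      (c 2 - c 4 - 3 / 4 * (c 0 - c 1)) ^ 2 / 3 + 9 / 16 * (c 0 - c 1) ^ 2 +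
      3 / 2 * (c 3 - (c 2 - c 4) / 3) ^ 2 := by
    simp [B, G10, dotProduct, mulVec, Fin.sum_univ_succ]
    grind
  rw [key]
  by_contra! h
  have s0 := sq_nonneg (c 0 + c 1 - (c 2 + c 4))
  have s1 := sq_nonneg (c 2 + c 4)
  have s2 := sq_nonneg (c 2 - c 4 - 3 / 4 * (c 0 - c 1))
  have s3 := sq_nonneg (c 0 - c 1)
  have s4 := sq_nonneg (c 3 - (c 2 - c 4) / 3)
  have e0 : c 0 + c 1 - (c 2 + c 4) = 0 := sq_eq_zero_iff.1 (by linarith)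
  have e1 : c 2 + c 4 = 0 := sq_eq_zero_iff.1 (by linarith)
  have e2 : c 2 - c 4 - 3 / 4 * (c 0 - c 1) = 0 := sq_eq_zero_iff.1 (by linarith)
  have e3 : c 0 - c 1 = 0 := sq_eq_zero_iff.1 (by linarith)
  have e4 : c 3 - (c 2 - c 4) / 3 = 0 := sq_eq_zero_iff.1 (by linarith)
  refine hc (funext fun i ↦ ?_)
  fin_cases i <;> simp <;> linarith

lemma G10_rank_le : G10.rank ≤ 6 := by
  have h2 : √2 * √2 = (2 : ℝ) := Real.mul_self_sqrt (by norm_num)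
  let N : Matrix (Fin 8) (Fin 2) ℝ :=
    !![-1, 3; -1, -3; 0, 4; 0, -4; 3, 3; 3 * √2, √2; 3 * √2, -√2; 3, -3]
  let L : Matrix (Fin 2) (Fin 8) ℝ :=
    !![-(1/2), -(1/2), 0, 0, 0, 0, 0, 0; 0, 0, 1/4, 0, 0, 0, 0, 0]
  have hGN : G10 * N = 0 := by
    ext i j
    fin_cases i <;> fin_cases j <;>
      simp [G10, N, Matrix.mul_apply, Fin.sum_univ_succ] <;> linarith
  have hLN : L * N = 1 := by
    ext i j
    fin_cases i <;> fin_cases j <;>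
      simp [L, N, Matrix.mul_apply, Fin.sum_univ_succ]
    norm_num
  have hN : 2 ≤ N.rank := by
    simpa [hLN] using rank_mul_le_right L N
  have := rank_add_rank_le_card_of_mul_eq_zero hGN
  simp only [Fintype.card_fin] at this
  omega

theorem stmt_10 (hG : G10.IsHermitian) :
    (Finset.univ.filter fun j => 0 < hG.eigenvalues j).card = 5 ∧
    (Finset.univ.filter fun j => hG.eigenvalues j < 0).card = 1 ∧
    (Finset.univ.filter fun j => hG.eigenvalues j = 0).card = 2 ∧
    G10.rank = 6 := by
  have hpos := hG.card_le_card_pos_eigenvalues _ G10_pos_on_subspace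
  have hneg := hG.card_neg_eigenvalues_pos ![1, 1, 1, 1, 0, 0, 0, 0] <| by
    simp [G10, dotProduct, mulVec, Fin.sum_univ_succ]
    norm_num
  have hle := G10_rank_le
  have hrank := hG.rank_eq_card_non_zero_eigs
  rw [Fintype.card_subtype] at hrank
  have hnz : (Finset.univ.filter fun j => hG.eigenvalues j ≠ 0).card =
      (Finset.univ.filter fun j => 0 < hG.eigenvalues j).card +
      (Finset.univ.filter fun j => hG.eigenvalues j < 0).card := by
    rw [← Finset.card_union_of_disjoint, ← Finset.filter_or]
    · simp only [ne_iff_lt_or_gt, or_comm]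
    · exact Finset.disjoint_filter.2 fun _ _ h ↦ h.not_gt
  have hall := Finset.card_filter_add_card_filter_not (s := Finset.univ)
    (fun j => hG.eigenvalues j = 0)
  simp only [Finset.card_univ, Fintype.card_fin] at hall hpos
  simp only [ne_eq] at hnz hrank
  omega
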